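/- Lichnerowicz–Weitzenböck formula factorizing the ultrahyperbolic operator: if f : 𝕆 × 𝕆 → 𝕆_ℂ is twice continuously differentiable, then at every point p, D(D̄ f)(p) = D̄(D f)(p) = Δ_x f(p) − Δ_y f(p) + 2 i • Σ_{j=0}^{7} ∂_{x_j}(∂_{y_j} f)(p), where Δ_x f(p) := Σ_{j=0}^{7} (second derivative of f at p twice in direction (e_j,0)) and Δ_y f(p) := Σ_{j=0}^{7} (second derivative of f at p twice in direction (0,e_j)). -/

import Mathlib

noncomputable section

open scoped BigOperators

/-- The quaternions over ℝ. -/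
abbrev ℍ := Quaternion ℝ

/-- The octonions, modeled as Cayley–Dickson pairs of quaternions. -/
abbrev 𝕆 := ℍ × ℍ

/-- Cayley–Dickson multiplication on 𝕆 = ℍ × ℍ. -/
def omul (x y : 𝕆) : 𝕆 :=
  (x.1 * y.1 - star y.2 * x.2, x.2 * star y.1 + y.2 * x.1)

/-- The quaternion unit i. -/
def qi : ℍ := ⟨0, 1, 0, 0⟩
/-- The quaternion unit j. -/
def qj : ℍ := ⟨0, 0, 1, 0⟩
/-- The quaternion unit k. -/
def qk : ℍ := ⟨0, 0, 0, 1⟩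

/-- The standard basis e₀,…,e₇ of 𝕆 ≅ ℝ⁸. -/
def e : Fin 8 → 𝕆 :=
  ![(1, 0), (qi, 0), (qj, 0), (qk, 0), (0, 1), (0, qi), (0, qj), (0, qk)]

/-- The complexified octonions 𝕆_ℂ, modeled as pairs `(g, h)` standing for `g + i·h`. -/
abbrev 𝕆ℂ := 𝕆 × 𝕆

/-- Multiplication by the complex imaginary unit: `i • (g, h) = (−h, g)`. -/
def iSmul (z : 𝕆ℂ) : 𝕆ℂ := (-z.2, z.1)

/-- Left multiplication of 𝕆_ℂ by an octonion: `a • (g, h) = (a*g, a*h)`. -/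
def eSmul (a : 𝕆) (z : 𝕆ℂ) : 𝕆ℂ := (omul a z.1, omul a z.2)

/-- `∂_x F = ∂_{x_0}F + Σ_{j=1}^7 e_j * ∂_{x_j}F` for octonion-valued `F`. -/
def PxO (F : 𝕆 × 𝕆 → 𝕆) (p : 𝕆 × 𝕆) : 𝕆 :=
  fderiv ℝ F p (e 0, 0) + ∑ j : Fin 7, omul (e j.succ) (fderiv ℝ F p (e j.succ, 0))

/-- `∂_y F = ∂_{y_0}F + Σ_{j=1}^7 e_j * ∂_{y_j}F` for octonion-valued `F`. -/
def PyO (F : 𝕆 × 𝕆 → 𝕆) (p : 𝕆 × 𝕆) : 𝕆 :=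
  fderiv ℝ F p (0, e 0) + ∑ j : Fin 7, omul (e j.succ) (fderiv ℝ F p (0, e j.succ))

/-- `∂_x f = ∂_{x_0}f + Σ_{j=1}^7 e_j • ∂_{x_j}f` for 𝕆_ℂ-valued `f`. -/
def Px (f : 𝕆 × 𝕆 → 𝕆ℂ) (p : 𝕆 × 𝕆) : 𝕆ℂ :=
  fderiv ℝ f p (e 0, 0) + ∑ j : Fin 7, eSmul (e j.succ) (fderiv ℝ f p (e j.succ, 0))

/-- `∂_x̄ f = ∂_{x_0}f − Σ_{j=1}^7 e_j • ∂_{x_j}f` for 𝕆_ℂ-valued `f`. -/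
def Pxbar (f : 𝕆 × 𝕆 → 𝕆ℂ) (p : 𝕆 × 𝕆) : 𝕆ℂ :=
  fderiv ℝ f p (e 0, 0) - ∑ j : Fin 7, eSmul (e j.succ) (fderiv ℝ f p (e j.succ, 0))

/-- `∂_y f = ∂_{y_0}f + Σ_{j=1}^7 e_j • ∂_{y_j}f` for 𝕆_ℂ-valued `f`. -/
def Py (f : 𝕆 × 𝕆 → 𝕆ℂ) (p : 𝕆 × 𝕆) : 𝕆ℂ :=
  fderiv ℝ f p (0, e 0) + ∑ j : Fin 7, eSmul (e j.succ) (fderiv ℝ f p (0, e j.succ))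

/-- `∂_ȳ f = ∂_{y_0}f − Σ_{j=1}^7 e_j • ∂_{y_j}f` for 𝕆_ℂ-valued `f`. -/
def Pybar (f : 𝕆 × 𝕆 → 𝕆ℂ) (p : 𝕆 × 𝕆) : 𝕆ℂ :=
  fderiv ℝ f p (0, e 0) - ∑ j : Fin 7, eSmul (e j.succ) (fderiv ℝ f p (0, e j.succ))

/-- The complexified octonionic Cauchy–Riemann operator `D f = ∂_x f + i • ∂_y f`. -/
def D (f : 𝕆 × 𝕆 → 𝕆ℂ) (p : 𝕆 × 𝕆) : 𝕆ℂ := Px f p + iSmul (Py f p)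

/-- The octonionic conjugate operator `D̄ f = ∂_x̄ f + i • ∂_ȳ f`. -/
def Dbar (f : 𝕆 × 𝕆 → 𝕆ℂ) (p : 𝕆 × 𝕆) : 𝕆ℂ := Pxbar f p + iSmul (Pybar f p)

/-- The Hermitian conjugate operator `D⁺ f = ∂_x̄ f − i • ∂_ȳ f`. -/
def Dplus (f : 𝕆 × 𝕆 → 𝕆ℂ) (p : 𝕆 × 𝕆) : 𝕆ℂ := Pxbar f p - iSmul (Pybar f p)

/-- `Δ_x f(p) = Σ_{j=0}^7` (second derivative of `f` at `p` twice in direction `(e_j, 0)`). -/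
def lapX {E : Type*} [NormedAddCommGroup E] [NormedSpace ℝ E]
    (f : 𝕆 × 𝕆 → E) (p : 𝕆 × 𝕆) : E :=
  ∑ j : Fin 8, fderiv ℝ (fderiv ℝ f) p ((e j, 0) : 𝕆 × 𝕆) ((e j, 0) : 𝕆 × 𝕆)

/-- `Δ_y f(p) = Σ_{j=0}^7` (second derivative of `f` at `p` twice in direction `(0, e_j)`). -/
def lapY {E : Type*} [NormedAddCommGroup E] [NormedSpace ℝ E]
    (f : 𝕆 × 𝕆 → E) (p : 𝕆 × 𝕆) : E :=
  ∑ j : Fin 8, fderiv ℝ (fderiv ℝ f) p ((0, e j) : 𝕆 × 𝕆) ((0, e j) : 𝕆 × 𝕆)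

/-- The mixed term `Σ_{j=0}^7 ∂_{x_j} ∂_{y_j} f (p)`. -/
def mixXY {E : Type*} [NormedAddCommGroup E] [NormedSpace ℝ E]
    (f : 𝕆 × 𝕆 → E) (p : 𝕆 × 𝕆) : E :=
  ∑ j : Fin 8, fderiv ℝ (fun q => fderiv ℝ f q ((0, e j) : 𝕆 × 𝕆)) p ((e j, 0) : 𝕆 × 𝕆)

/-- Octonionic conjugation. -/
def oconj (a : 𝕆) : 𝕆 := (star a.1, -a.2)

/-- The Euclidean inner product of two octonions. -/
def oinner (a b : 𝕆) : ℝ :=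
  (a.1.re * b.1.re + a.1.imI * b.1.imI + a.1.imJ * b.1.imJ + a.1.imK * b.1.imK) +
  (a.2.re * b.2.re + a.2.imI * b.2.imI + a.2.imJ * b.2.imJ + a.2.imK * b.2.imK)

set_option maxHeartbeats 2000000 in
/-- The left-multiplication operators satisfy the polarized composition identity. -/
theorem omul_oconj_add (a b z : 𝕆) :
    omul a (omul (oconj b) z) + omul b (omul (oconj a) z) = (2 * oinner a b) • z := by
  ext <;> simp [omul, oconj, oinner] <;> ring

theorem oconj_oconj (a : 𝕆) : oconj (oconj a) = a := by simp [oconj]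

theorem oinner_oconj (a b : 𝕆) : oinner (oconj a) (oconj b) = oinner a b := by
  simp [oinner, oconj]

open scoped Quaternion in
theorem oinner_e (i j : Fin 8) : oinner (e i) (e j) = if i = j then 1 else 0 := by
  fin_cases i <;> fin_cases j <;> simp [oinner, e, qi, qj, qk]

open scoped Quaternion in
theorem omul_e_zero (z : 𝕆) : omul (e 0) z = z := by simp [omul, e]

open scoped Quaternion in
theorem oconj_e_zero : oconj (e 0) = e 0 := by simp [oconj, e]

theorem star_qi : star qi = -qi := by ext <;> simp; simp [qi]

theorem star_qj : star qj = -qj := by ext <;> simp; simp [qj]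

theorem star_qk : star qk = -qk := by ext <;> simp; simp [qk]

theorem oconj_e_succ (j : Fin 7) : oconj (e j.succ) = -e j.succ := by
  fin_cases j <;> simp [oconj, e, star_qi, star_qj, star_qk]

theorem omul_neg_left (a z : 𝕆) : omul (-a) z = -omul a z := by
  ext1 <;> simp [omul] <;> abel

theorem omul_neg_right (a z : 𝕆) : omul a (-z) = -omul a z := by
  ext1 <;> simp [omul] <;> abel

theorem omul_add (a y z : 𝕆) : omul a (y + z) = omul a y + omul a z := by
  ext1 <;> simp [omul, mul_add, add_mul] <;> abel

theorem omul_smul (c : ℝ) (a z : 𝕆) : omul a (c • z) = c • omul a z := by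
  ext1 <;> simp [omul, smul_sub, smul_add]

/-- Left multiplication by an octonion on `𝕆ℂ`, as a continuous linear map. -/
def leftMul (a : 𝕆) : 𝕆ℂ →L[ℝ] 𝕆ℂ :=
  LinearMap.toContinuousLinearMap
    { toFun := eSmul a
      map_add' := fun x y => by simp [eSmul, omul_add]
      map_smul' := fun c x => by simp [eSmul, omul_smul] }

/-- Multiplication by the complex unit on `𝕆ℂ`, as a continuous linear map. -/
def iMul : 𝕆ℂ →L[ℝ] 𝕆ℂ :=
  LinearMap.toContinuousLinearMap
    { toFun := iSmul
      map_add' := fun x y => by simp [iSmul, add_comm]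
      map_smul' := fun c x => by simp [iSmul] }

theorem leftMul_apply (a : 𝕆) (z : 𝕆ℂ) : leftMul a z = eSmul a z := rfl

theorem iMul_apply (z : 𝕆ℂ) : iMul z = iSmul z := rfl

theorem iMul_iMul (z : 𝕆ℂ) : iMul (iMul z) = -z := by
  ext1 <;> simp [iMul_apply, iSmul]

theorem leftMul_iMul (a : 𝕆) (z : 𝕆ℂ) : leftMul a (iMul z) = iMul (leftMul a z) := by
  simp [iMul_apply, leftMul_apply, iSmul, eSmul, omul_neg_right]

theorem leftMul_e_zero (z : 𝕆ℂ) : leftMul (e 0) z = z := by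
  simp [leftMul_apply, eSmul, omul_e_zero]

theorem leftMul_neg (a : 𝕆) (z : 𝕆ℂ) : leftMul (-a) z = -leftMul a z := by
  ext1 <;> simp [leftMul_apply, eSmul, omul_neg_left]

theorem leftMul_clifford (i j : Fin 8) (z : 𝕆ℂ) :
    leftMul (e i) (leftMul (oconj (e j)) z) + leftMul (e j) (leftMul (oconj (e i)) z) =
      if i = j then (2 : ℝ) • z else 0 := by
  simp only [leftMul_apply, eSmul, Prod.mk_add_mk, omul_oconj_add, oinner_e]
  split_ifs <;> simp [Prod.smul_def]

theorem leftMul_oconj_clifford (i j : Fin 8) (z : 𝕆ℂ) :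
    leftMul (oconj (e i)) (leftMul (e j) z) + leftMul (oconj (e j)) (leftMul (e i) z) =
      if i = j then (2 : ℝ) • z else 0 := by
  have h (x y : 𝕆) (w : 𝕆) : omul (oconj x) (omul y w) + omul (oconj y) (omul x w) =
      (2 * oinner x y) • w := by
    simpa only [oconj_oconj, oinner_oconj] using omul_oconj_add (oconj x) (oconj y) w
  simp only [leftMul_apply, eSmul, Prod.mk_add_mk, h, oinner_e]
  split_ifs <;> simp [Prod.smul_def]

/-- The first-order operator with coefficients `leftMul (a j)` in the directions
`(e j, 0)` and `i • leftMul (a j)` in the directions `(0, e j)`. -/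
def diracOp (a : Fin 8 → 𝕆) (f : 𝕆 × 𝕆 → 𝕆ℂ) (p : 𝕆 × 𝕆) : 𝕆ℂ :=
  ∑ j, leftMul (a j) (fderiv ℝ f p (e j, 0)) +
    iMul (∑ j, leftMul (a j) (fderiv ℝ f p (0, e j)))

theorem D_eq_diracOp (f : 𝕆 × 𝕆 → 𝕆ℂ) : D f = diracOp e f := by
  funext p
  simp only [D, Px, Py, diracOp, Fin.sum_univ_succ (n := 7), leftMul_e_zero]
  rfl

theorem Dbar_eq_diracOp (f : 𝕆 × 𝕆 → 𝕆ℂ) : Dbar f = diracOp (fun j => oconj (e j)) f := by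
  funext p
  simp only [Dbar, Pxbar, Pybar, diracOp, Fin.sum_univ_succ (n := 7), oconj_e_zero,
    oconj_e_succ, leftMul_e_zero, leftMul_neg, Finset.sum_neg_distrib, sub_eq_add_neg]
  rfl

theorem fderiv_fderiv_apply {f : 𝕆 × 𝕆 → 𝕆ℂ} (hf : ContDiff ℝ 2 f) (p v w : 𝕆 × 𝕆) :
    fderiv ℝ (fun q => fderiv ℝ f q w) p v = fderiv ℝ (fderiv ℝ f) p v w := by
  have h : DifferentiableAt ℝ (fderiv ℝ f) p :=
    ((hf.fderiv_right (m := 1) (by norm_num)).differentiable one_ne_zero) p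
  rw [(h.hasFDerivAt.clm_apply (hasFDerivAt_const w p)).fderiv]
  simp

theorem fderiv_diracOp {f : 𝕆 × 𝕆 → 𝕆ℂ} (hf : ContDiff ℝ 2 f) (a : Fin 8 → 𝕆)
    (p v : 𝕆 × 𝕆) :
    fderiv ℝ (diracOp a f) p v =
      ∑ j, leftMul (a j) (fderiv ℝ (fderiv ℝ f) p v (e j, 0)) +
        iMul (∑ j, leftMul (a j) (fderiv ℝ (fderiv ℝ f) p v (0, e j))) := by
  have h : DifferentiableAt ℝ (fderiv ℝ f) p :=
    ((hf.fderiv_right (m := 1) (by norm_num)).differentiable one_ne_zero) p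
  have hw (w : 𝕆 × 𝕆) := h.hasFDerivAt.clm_apply (hasFDerivAt_const w p)
  have hx : HasFDerivAt (diracOp a f) _ p :=
    (HasFDerivAt.fun_sum fun j (_ : j ∈ Finset.univ) =>
      (leftMul (a j)).hasFDerivAt.comp p (hw (e j, 0))).add
    (iMul.hasFDerivAt.comp p (HasFDerivAt.fun_sum fun j (_ : j ∈ Finset.univ) =>
      (leftMul (a j)).hasFDerivAt.comp p (hw (0, e j))))
  rw [hx.fderiv]
  simp

theorem sum_clifford_add_swap {a b : Fin 8 → 𝕆}
    (hab : ∀ i j z, leftMul (a i) (leftMul (b j) z) + leftMul (a j) (leftMul (b i) z) =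
      if i = j then (2 : ℝ) • z else 0) (T : Fin 8 → Fin 8 → 𝕆ℂ) :
    ∑ i, ∑ j, leftMul (a i) (leftMul (b j) (T i j)) +
      ∑ i, ∑ j, leftMul (a i) (leftMul (b j) (T j i)) = (2 : ℝ) • ∑ i, T i i := by
  rw [Finset.sum_comm (f := fun i j => leftMul (a i) (leftMul (b j) (T j i)))]
  simp only [← Finset.sum_add_distrib, hab, Finset.sum_ite_eq, Finset.mem_univ, if_true,
    Finset.smul_sum]

theorem diracOp_diracOp {f : 𝕆 × 𝕆 → 𝕆ℂ} (hf : ContDiff ℝ 2 f) {a b : Fin 8 → 𝕆}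
    (hab : ∀ i j z, leftMul (a i) (leftMul (b j) z) + leftMul (a j) (leftMul (b i) z) =
      if i = j then (2 : ℝ) • z else 0) (p : 𝕆 × 𝕆) :
    diracOp a (diracOp b f) p = lapX f p - lapY f p + (2 : ℝ) • iSmul (mixXY f p) := by
  have hsymm (v w : 𝕆 × 𝕆) :
      fderiv ℝ (fderiv ℝ f) p v w = fderiv ℝ (fderiv ℝ f) p w v :=
    (hf.contDiffAt.isSymmSndFDerivAt (by simp)).eq v w
  have hdiag (ι : 𝕆 → 𝕆 × 𝕆) :
      ∑ i, ∑ j, leftMul (a i) (leftMul (b j)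
        (fderiv ℝ (fderiv ℝ f) p (ι (e i)) (ι (e j)))) =
      ∑ j, fderiv ℝ (fderiv ℝ f) p (ι (e j)) (ι (e j)) := by
    have h := sum_clifford_add_swap hab
      fun i j => fderiv ℝ (fderiv ℝ f) p (ι (e i)) (ι (e j))
    have hswap :
        ∑ i, ∑ j, leftMul (a i) (leftMul (b j)
          (fderiv ℝ (fderiv ℝ f) p (ι (e j)) (ι (e i)))) =
        ∑ i, ∑ j, leftMul (a i) (leftMul (b j)
          (fderiv ℝ (fderiv ℝ f) p (ι (e i)) (ι (e j)))) :=
      Finset.sum_congr rfl fun i _ => Finset.sum_congr rfl fun j _ => by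
        rw [hsymm (ι (e j))]
    rw [hswap, ← two_smul ℝ] at h
    exact smul_right_injective _ (two_ne_zero (α := ℝ)) h
  have hmix := sum_clifford_add_swap hab
    fun i j => fderiv ℝ (fderiv ℝ f) p (e i, 0) (0, e j)
  have hx := hdiag fun c => (c, 0)
  have hy := hdiag fun c => (0, c)
  simp only [diracOp.eq_def a, fderiv_diracOp hf, lapX, lapY, mixXY, fderiv_fderiv_apply hf,
    ← iMul_apply, ← map_smul, ← hmix, ← hx, ← hy]
  simp only [map_add, map_sum, leftMul_iMul, iMul_iMul, Finset.sum_add_distrib,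
    Finset.sum_neg_distrib, hsymm (0, e _) (e _, 0)]
  abel

/-- Lichnerowicz–Weitzenböck formula factorizing the ultrahyperbolic operator:
for `f` twice continuously differentiable,
`D D̄ f = D̄ D f = Δ_x f − Δ_y f + 2 i • Σ_j ∂_{x_j} ∂_{y_j} f`. -/
theorem LW_ultrahyperbolic (f : 𝕆 × 𝕆 → 𝕆ℂ) (hf : ContDiff ℝ 2 f) (p : 𝕆 × 𝕆) :
    D (fun q => Dbar f q) p = lapX f p - lapY f p + (2 : ℝ) • iSmul (mixXY f p) ∧
    Dbar (fun q => D f q) p = lapX f p - lapY f p + (2 : ℝ) • iSmul (mixXY f p) := by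
  simp only [D_eq_diracOp, Dbar_eq_diracOp]
  exact ⟨diracOp_diracOp hf leftMul_clifford p, diracOp_diracOp hf leftMul_oconj_clifford p⟩
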